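/- arXiv:1910.12107 — 8 statements merged into one kernel-verified Lean document; each statement's English description precedes it below -/
import Mathlib

section
/- Let G be a connected infinite simple graph and let k be a natural number. If G admits a proper edge colouring with k colours, then G admits a proper edge colouring with k + 1 colours that is preserved only by the identity automorphism; that is, χ'_D(G) ≤ χ'(G) + 1. -/
open SimpleGraph

/-- A vertex colouring is proper if adjacent vertices receive distinct colours. -/
def IsProperVertexColoring {V α : Type*} (G : SimpleGraph V) (c : V → α) : Prop :=
  ∀ u v, G.Adj u v → c u ≠ c v

/-- A vertex colouring is distinguishing if the identity is the only automorphism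
preserving it. -/
def IsDistinguishingVertexColoring {V α : Type*} (G : SimpleGraph V) (c : V → α) : Prop :=
  ∀ φ : G ≃g G, (∀ v, c (φ v) = c v) → ∀ v, φ v = v

/-- An edge colouring is proper if distinct edges sharing a vertex receive distinct
colours. -/
def IsProperEdgeColoring {V α : Type*} (G : SimpleGraph V) (c : Sym2 V → α) : Prop :=
  ∀ u v w, G.Adj u v → G.Adj u w → v ≠ w → c s(u, v) ≠ c s(u, w)

/-- An edge colouring is distinguishing if the identity is the only automorphism
preserving it. -/
def IsDistinguishingEdgeColoring {V α : Type*} (G : SimpleGraph V) (c : Sym2 V → α) : Prop :=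
  ∀ φ : G ≃g G, (∀ u v, G.Adj u v → c s(φ u, φ v) = c s(u, v)) → ∀ v, φ v = v

/-- A total colouring (of vertices and edges) is proper if adjacent vertices get distinct
colours, incident edges get distinct colours, and every vertex gets a colour distinct
from every edge incident with it. -/
def IsProperTotalColoring {V α : Type*} (G : SimpleGraph V) (cv : V → α) (ce : Sym2 V → α) :
    Prop :=
  (∀ u v, G.Adj u v → cv u ≠ cv v) ∧
  (∀ u v w, G.Adj u v → G.Adj u w → v ≠ w → ce s(u, v) ≠ ce s(u, w)) ∧
  (∀ u v, G.Adj u v → cv u ≠ ce s(u, v))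

/-- A total colouring is distinguishing if the identity is the only automorphism
preserving it. -/
def IsDistinguishingTotalColoring {V α : Type*} (G : SimpleGraph V) (cv : V → α)
    (ce : Sym2 V → α) : Prop :=
  ∀ φ : G ≃g G,
    ((∀ v, cv (φ v) = cv v) ∧ (∀ u v, G.Adj u v → ce s(φ u, φ v) = ce s(u, v))) →
    ∀ v, φ v = v

namespace SimpleGraph

variable {V W : Type*} {G : SimpleGraph V} {H : SimpleGraph W}

theorem Connected.dist_map_le (hG : G.Connected) (φ : G →g H) (u v : V) :
    H.dist (φ u) (φ v) ≤ G.dist u v := by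
  obtain ⟨p, hp⟩ := hG.exists_walk_length_eq_dist u v
  rw [← hp, ← Walk.length_map φ p]
  exact dist_le _

theorem Connected.dist_map_iso (hG : G.Connected) (φ : G ≃g H) (u v : V) :
    H.dist (φ u) (φ v) = G.dist u v := by
  refine le_antisymm (hG.dist_map_le φ.toHom u v) ?_
  simpa using (φ.connected_iff.1 hG).dist_map_le φ.symm.toHom (φ u) (φ v)

theorem Connected.finite_setOf_dist_le (hG : G.Connected)
    (hfin : ∀ v, (G.neighborSet v).Finite) (a : V) (n : ℕ) : {v | G.dist v a ≤ n}.Finite := by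
  induction n with
  | zero =>
    refine (Set.finite_singleton a).subset fun v hv => ?_
    exact hG.dist_eq_zero_iff.1 (Nat.le_zero.1 hv)
  | succ n ih =>
    refine ((Set.finite_singleton a).union (ih.biUnion fun u _ => hfin u)).subset fun v hv => ?_
    obtain ⟨p, hp⟩ := hG.exists_walk_length_eq_dist v a
    cases p with
    | nil => exact Or.inl rfl
    | @cons _ u _ h p =>
      refine Or.inr (Set.mem_biUnion (x := u) ?_ h.symm)
      have := dist_le p
      simp only [Walk.length_cons, Set.mem_ofPred_eq] at hp hv ⊢
      omega

theorem Connected.exists_lt_dist [Infinite V] (hG : G.Connected)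
    (hfin : ∀ v, (G.neighborSet v).Finite) (a : V) (n : ℕ) : ∃ v, n < G.dist v a := by
  by_contra! h
  exact Set.infinite_univ ((hG.finite_setOf_dist_le hfin a n).subset fun v _ => h v)

theorem Walk.dist_getVert_of_length_eq_dist {a b : V} (hG : G.Connected) (p : G.Walk a b)
    (hp : p.length = G.dist a b) {i j : ℕ} (hij : i ≤ j) (hj : j ≤ p.length) :
    G.dist (p.getVert i) (p.getVert j) = j - i := by
  have key : ∀ i m, i + m ≤ p.length → G.dist (p.getVert i) (p.getVert (i + m)) ≤ m := by
    intro i m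
    induction m with
    | zero => simp
    | succ m ih =>
      intro h
      have h₁ := ih (by omega)
      have h₂ := dist_eq_one_iff_adj.2 (p.adj_getVert_succ (i := i + m) (by omega))
      have h₃ := hG.dist_triangle (u := p.getVert i) (v := p.getVert (i + m))
        (w := p.getVert (i + m + 1))
      rw [← add_assoc]
      omega
  have h₁ := key 0 i (by omega)
  have h₂ := key i (j - i) (by omega)
  have h₃ := key j (p.length - j) (by omega)
  rw [Nat.zero_add, p.getVert_zero] at h₁
  rw [Nat.add_sub_cancel' hij] at h₂
  rw [Nat.add_sub_cancel' hj, p.getVert_length] at h₃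
  have h₄ := hG.dist_triangle (u := a) (v := p.getVert i) (w := b)
  have h₅ := hG.dist_triangle (u := p.getVert i) (v := p.getVert j) (w := b)
  omega

end SimpleGraph

namespace IsProperEdgeColoring

variable {V α : Type*} {G : SimpleGraph V} {c : Sym2 V → α}

theorem finite_neighborSet [Finite α] (hc : IsProperEdgeColoring G c) (v : V) :
    (G.neighborSet v).Finite := by
  refine Set.Finite.of_finite_image (f := fun w => c s(v, w)) (Set.toFinite _) ?_
  intro x hx y hy h
  by_contra hne
  exact hc v x y hx hy hne h

/-- A colour-preserving automorphism of a connected graph with a fixed vertex is trivial. -/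
theorem eq_of_apply_eq (hc : IsProperEdgeColoring G c) (hG : G.Connected) (φ : G ≃g G)
    (hφ : ∀ u v, G.Adj u v → c s(φ u, φ v) = c s(u, v)) {a : V} (ha : φ a = a) (v : V) :
    φ v = v := by
  obtain ⟨p⟩ := hG.preconnected a v
  induction p with
  | nil => exact ha
  | @cons a u _ h p ih =>
    refine ih ?_
    by_contra hne
    have hadj : G.Adj a (φ u) := by simpa [ha] using φ.map_adj_iff.2 h
    have hcol := hφ a u h
    rw [ha] at hcol
    exact hc a (φ u) u hadj h hne hcol

open Classical in
/-- Recolouring a matching with a new colour keeps a colouring proper. -/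
theorem recolor {k : ℕ} {c : Sym2 V → Fin k} (hc : IsProperEdgeColoring G c) {M : Set (Sym2 V)}
    (hM : ∀ u v w, s(u, v) ∈ M → s(u, w) ∈ M → v = w) :
    IsProperEdgeColoring G fun e => if e ∈ M then Fin.last k else (c e).castSucc := by
  intro u v w hv hw hne
  dsimp only
  split_ifs with h₁ h₂ h₂
  · exact absurd (hM u v w h₁ h₂) hne
  · exact (Fin.castSucc_ne_last _).symm
  · exact Fin.castSucc_ne_last _
  · exact fun h => hc u v w hv hw hne (Fin.castSucc_injective _ h)

end IsProperEdgeColoring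

/-- If a connected infinite graph admits a proper edge colouring with `k` colours, then
it admits a proper distinguishing edge colouring with `k + 1` colours;
i.e. `χ'_D(G) ≤ χ'(G) + 1`. -/
theorem distinguishingChromaticIndex_le_chromaticIndex_add_one
    {V : Type*} [Infinite V] (G : SimpleGraph V) (hG : G.Connected) (k : ℕ)
    (c : Sym2 V → Fin k) (hc : IsProperEdgeColoring G c) :
    ∃ c' : Sym2 V → Fin (k + 1),
      IsProperEdgeColoring G c' ∧ IsDistinguishingEdgeColoring G c' := by
  classical
  -- Recolour the edges `01`, `23` and `56` of a geodesic: every automorphism preserving this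
  -- set of three edges fixes the vertex `0`.
  obtain ⟨b⟩ : Nonempty V := inferInstance
  obtain ⟨a, hab⟩ := hG.exists_lt_dist hc.finite_neighborSet b 6
  obtain ⟨p, hp⟩ := hG.exists_walk_length_eq_dist a b
  set f := p.getVert
  have hdist : ∀ i j, i ≤ 6 → j ≤ 6 → G.dist (f i) (f j) = (j - i) + (i - j) := by
    intro i j hi hj
    rcases le_total i j with h | h
    · rw [p.dist_getVert_of_length_eq_dist hG hp h (by omega)]
      omega
    · rw [SimpleGraph.dist_comm, p.dist_getVert_of_length_eq_dist hG hp h (by omega)]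
      omega
  have hinj : ∀ i j, i ≤ 6 → j ≤ 6 → f i = f j → i = j := by
    intro i j hi hj h
    have := hdist i j hi hj
    rw [h, SimpleGraph.dist_self] at this
    omega
  let P : ℕ → ℕ → Prop := fun i j =>
    (i = 0 ∧ j = 1) ∨ (i = 1 ∧ j = 0) ∨ (i = 2 ∧ j = 3) ∨ (i = 3 ∧ j = 2) ∨
      (i = 5 ∧ j = 6) ∨ (i = 6 ∧ j = 5)
  let M : Set (Sym2 V) := {s(f 0, f 1), s(f 2, f 3), s(f 5, f 6)}
  have hM : ∀ u v, s(u, v) ∈ M ↔ ∃ i j, P i j ∧ u = f i ∧ v = f j := by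
    intro u v
    simp only [M, P, Set.mem_insert_iff, Set.mem_singleton_iff, Sym2.eq_iff]
    constructor
    · rintro ((⟨rfl, rfl⟩ | ⟨rfl, rfl⟩) | (⟨rfl, rfl⟩ | ⟨rfl, rfl⟩) | ⟨rfl, rfl⟩ | ⟨rfl, rfl⟩) <;>
        exact ⟨_, _, by simp, rfl, rfl⟩
    · rintro ⟨i, j, h, rfl, rfl⟩
      rcases h with ⟨rfl, rfl⟩ | ⟨rfl, rfl⟩ | ⟨rfl, rfl⟩ | ⟨rfl, rfl⟩ | ⟨rfl, rfl⟩ | ⟨rfl, rfl⟩ <;>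
        simp
  have hproper := hc.recolor (M := M) (by
    intro u v w hv hw
    obtain ⟨i, j, hij, rfl, rfl⟩ := (hM _ _).1 hv
    obtain ⟨i', j', hij', h, rfl⟩ := (hM _ _).1 hw
    have := hinj i i' (by omega) (by omega) h
    congr 1
    omega)
  refine ⟨_, hproper, fun φ hφ => hproper.eq_of_apply_eq hG φ hφ (a := f 0) ?_⟩
  have himg : ∀ i j, P i j → ∃ i' j', P i' j' ∧ φ (f i) = f i' := by
    intro i j hij
    have hmem : s(f i, f j) ∈ M := (hM _ _).2 ⟨i, j, hij, rfl, rfl⟩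
    have hadj : G.Adj (f i) (f j) := by
      rw [← SimpleGraph.dist_eq_one_iff_adj, hdist i j (by omega) (by omega)]
      omega
    have hcol := hφ _ _ hadj
    have hmem' : s(φ (f i), φ (f j)) ∈ M := by
      by_contra hnot
      rw [if_pos hmem, if_neg hnot] at hcol
      exact Fin.castSucc_ne_last _ hcol
    obtain ⟨i', j', h, h₁, -⟩ := (hM _ _).1 hmem'
    exact ⟨i', j', h, h₁⟩
  obtain ⟨x, x', hx, hx0⟩ := himg 0 1 (by omega)
  obtain ⟨y, y', hy, hy2⟩ := himg 2 3 (by omega)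
  obtain ⟨z, z', hz, hz6⟩ := himg 6 5 (by omega)
  have h₁ := hG.dist_map_iso φ (f 0) (f 2)
  have h₂ := hG.dist_map_iso φ (f 0) (f 6)
  rw [hx0, hy2, hdist x y (by omega) (by omega), hdist 0 2 (by omega) (by omega)] at h₁
  rw [hx0, hz6, hdist x z (by omega) (by omega), hdist 0 6 (by omega) (by omega)] at h₂
  rw [hx0]
  congr 1
  omega
end

section
/- Let G be a connected simple graph with a proper total colouring c, and suppose there exists a vertex v such that φ(v) = v for every automorphism φ of G that preserves c. Then the identity is the only automorphism of G preserving c (i.e., c is a distinguishing total colouring). -/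
open SimpleGraph

/-- An automorphism preserving a proper edge colouring fixes every neighbour of a vertex
it fixes. -/
theorem IsProperEdgeColoring.apply_eq_of_adj {V α : Type*} {G : SimpleGraph V}
    {c : Sym2 V → α} (hc : IsProperEdgeColoring G c) (φ : G ≃g G)
    (hφ : ∀ u v, G.Adj u v → c s(φ u, φ v) = c s(u, v)) {u v : V} (huv : G.Adj u v)
    (hu : φ u = u) : φ v = v := by
  by_contra hv
  have hadj : G.Adj u (φ v) := by
    simpa only [hu] using φ.map_adj_iff.mpr huv
  refine hc u (φ v) v hadj huv hv ?_
  simpa only [hu] using hφ u v huv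

/-- An automorphism of a connected graph that preserves a proper edge colouring and fixes
a vertex is the identity. -/
theorem IsProperEdgeColoring.apply_eq_of_connected {V α : Type*} {G : SimpleGraph V}
    {c : Sym2 V → α} (hc : IsProperEdgeColoring G c) (hG : G.Connected) (φ : G ≃g G)
    (hφ : ∀ u v, G.Adj u v → c s(φ u, φ v) = c s(u, v)) {u : V} (hu : φ u = u) (v : V) :
    φ v = v := by
  obtain ⟨p⟩ := hG.preconnected u v
  induction p with
  | nil => exact hu
  | cons huv _ ih => exact ih (hc.apply_eq_of_adj φ hφ huv hu)

/-- If a connected graph has a proper total colouring and some vertex is fixed by every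
colour-preserving automorphism, then the colouring is distinguishing. -/
theorem properTotalColoring_fixed_vertex_distinguishing
    {V α : Type*} (G : SimpleGraph V) (hG : G.Connected)
    (cv : V → α) (ce : Sym2 V → α) (h : IsProperTotalColoring G cv ce)
    (hfix : ∃ v, ∀ φ : G ≃g G,
      ((∀ w, cv (φ w) = cv w) ∧ (∀ u w, G.Adj u w → ce s(φ u, φ w) = ce s(u, w))) →
      φ v = v) :
    IsDistinguishingTotalColoring G cv ce := by
  obtain ⟨v, hv⟩ := hfix
  intro φ hφ
  exact IsProperEdgeColoring.apply_eq_of_connected h.2.1 hG φ hφ.2 (hv φ hφ)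
end

section
/- Let G be a connected simple graph with a proper edge colouring c, and suppose there exists a vertex v such that φ(v) = v for every automorphism φ of G that preserves c. Then the identity is the only automorphism of G preserving c (i.e., c is a distinguishing edge colouring). -/
open SimpleGraph

/-- If an automorphism preserves a proper edge colouring and fixes a vertex, then it fixes the end
of every walk starting at that vertex. -/
theorem IsProperEdgeColoring.apply_eq_of_walk {V α : Type*} {G : SimpleGraph V} {c : Sym2 V → α}
    (h : IsProperEdgeColoring G c) (φ : G ≃g G)
    (hφ : ∀ u v, G.Adj u v → c s(φ u, φ v) = c s(u, v)) {v w : V} (hv : φ v = v)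
    (p : G.Walk v w) : φ w = w := by
  induction p with
  | nil => exact hv
  | @cons u x _ hux _ ih =>
    apply ih
    by_contra hne
    have hadj : G.Adj u (φ x) := hv ▸ φ.map_adj_iff.mpr hux
    have hcol := hφ u x hux
    rw [hv] at hcol
    exact h u (φ x) x hadj hux hne hcol

/-- If a connected graph has a proper edge colouring and some vertex is fixed by every
colour-preserving automorphism, then the colouring is distinguishing. -/
theorem properEdgeColoring_fixed_vertex_distinguishing
    {V α : Type*} (G : SimpleGraph V) (hG : G.Connected)
    (c : Sym2 V → α) (h : IsProperEdgeColoring G c)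
    (hfix : ∃ v, ∀ φ : G ≃g G,
      (∀ u w, G.Adj u w → c s(φ u, φ w) = c s(u, w)) → φ v = v) :
    IsDistinguishingEdgeColoring G c := by
  obtain ⟨v, hv⟩ := hfix
  intro φ hφ w
  exact h.apply_eq_of_walk φ hφ (hv φ hφ) (hG.preconnected v w).some
end

section
/- Let T be an infinite rayless tree (a connected acyclic infinite simple graph containing no ray as a subgraph) that has a central vertex, i.e., a vertex fixed by every automorphism of T. Then for every natural number k, if T admits a distinguishing vertex colouring with k colours, then T admits a distinguishing edge colouring with k colours; that is, D'(T) ≤ D(T). -/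
open SimpleGraph

/-- A vertex different from `r` has a neighbour strictly closer to `r`. -/
theorem SimpleGraph.Connected.exists_adj_dist_lt {V : Type*} {G : SimpleGraph V}
    (hG : G.Connected) {r v : V} (hv : v ≠ r) : ∃ u, G.Adj u v ∧ G.dist r u < G.dist r v := by
  obtain ⟨p, hp⟩ := hG.exists_walk_length_eq_dist v r
  cases p with
  | nil => exact absurd rfl hv
  | cons h q =>
    refine ⟨_, h.symm, ?_⟩
    have := dist_le q
    rw [Walk.length_cons] at hp
    rw [dist_comm, dist_comm (u := r)]
    omega

/-- Graph isomorphisms do not increase distances in a connected graph. -/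
theorem SimpleGraph.Connected.dist_iso_le {V W : Type*} {G : SimpleGraph V} {H : SimpleGraph W}
    (hG : G.Connected) (φ : G ≃g H) (u v : V) : H.dist (φ u) (φ v) ≤ G.dist u v := by
  obtain ⟨p, hp⟩ := hG.exists_walk_length_eq_dist u v
  rw [← hp, ← Walk.length_map φ.toHom p]
  exact dist_le _

theorem SimpleGraph.Connected.dist_iso {V : Type*} {G : SimpleGraph V}
    (hG : G.Connected) (φ : G ≃g G) (u v : V) : G.dist (φ u) (φ v) = G.dist u v := by
  refine le_antisymm (hG.dist_iso_le φ u v) ?_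
  simpa using hG.dist_iso_le φ.symm (φ u) (φ v)

/-- The edge colouring giving each edge the colour of its endpoint farther from `r`
(and the colour of `r` if the endpoints are equidistant from `r`). -/
noncomputable def SimpleGraph.fartherEndpointColoring {V α : Type*} (G : SimpleGraph V) (r : V)
    (c : V → α) : Sym2 V → α :=
  Sym2.lift ⟨fun u v => if G.dist r u < G.dist r v then c v
    else if G.dist r v < G.dist r u then c u else c r, fun u v => by
      dsimp only
      split_ifs <;> first | rfl | omega⟩

theorem SimpleGraph.fartherEndpointColoring_of_lt {V α : Type*} {G : SimpleGraph V} {r : V}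
    (c : V → α) {u v : V} (h : G.dist r u < G.dist r v) :
    G.fartherEndpointColoring r c s(u, v) = c v := by
  simp [fartherEndpointColoring, h]

/-- If every automorphism fixes `r`, then colouring every edge by its endpoint farther from `r`
turns a distinguishing vertex colouring into a distinguishing edge colouring. -/
theorem IsDistinguishingVertexColoring.fartherEndpointColoring {V α : Type*} {G : SimpleGraph V}
    (hG : G.Connected) {r : V} (hr : ∀ φ : G ≃g G, φ r = r) {c : V → α}
    (hc : IsDistinguishingVertexColoring G c) :
    IsDistinguishingEdgeColoring G (G.fartherEndpointColoring r c) := by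
  intro φ hφ
  refine hc φ fun v => ?_
  by_cases hv : v = r
  · rw [hv, hr φ]
  obtain ⟨u, huv, hlt⟩ := hG.exists_adj_dist_lt hv
  have hdist (w : V) : G.dist r (φ w) = G.dist r w := by
    simpa only [hr φ] using hG.dist_iso φ r w
  have hlt' : G.dist r (φ u) < G.dist r (φ v) := by rwa [hdist, hdist]
  simpa only [fartherEndpointColoring_of_lt c hlt, fartherEndpointColoring_of_lt c hlt'] using
    hφ u v huv

/-- For an infinite rayless tree with a central vertex (a vertex fixed by every
automorphism), a distinguishing vertex colouring with `k` colours yields a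
distinguishing edge colouring with `k` colours; i.e. `D'(T) ≤ D(T)`. -/
theorem rayless_tree_central_vertex_distinguishingIndex_le_distinguishingNumber
    {V : Type*} [Infinite V] (T : SimpleGraph V) (hT : T.IsTree)
    (hrayless : ¬ ∃ f : ℕ → V, Function.Injective f ∧ ∀ n, T.Adj (f n) (f (n + 1)))
    (hcentral : ∃ v, ∀ φ : T ≃g T, φ v = v)
    (k : ℕ) (c : V → Fin k) (hc : IsDistinguishingVertexColoring T c) :
    ∃ c' : Sym2 V → Fin k, IsDistinguishingEdgeColoring T c' := by
  obtain ⟨r, hr⟩ := hcentral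
  exact ⟨_, hc.fartherEndpointColoring hT.connected hr⟩
end

section
/- Every proper total colouring of the double ray (the graph on vertex set ℤ with i adjacent to j iff |i − j| = 1) using only 3 colours is preserved by some non-identity automorphism; consequently the total distinguishing chromatic number of the double ray equals 4, i.e., χ''_D(P_∞) = χ''(P_∞) + 1 = 4. -/
open SimpleGraph

/-- The double ray: the graph on `ℤ` with `i` adjacent to `j` iff `|i - j| = 1`. -/
def doubleRay : SimpleGraph ℤ := SimpleGraph.fromRel (fun i j => j = i + 1)

theorem doubleRay_adj {i j : ℤ} : doubleRay.Adj i j ↔ j = i + 1 ∨ i = j + 1 := by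
  simp only [doubleRay, SimpleGraph.fromRel_adj]
  omega

theorem doubleRay_adj_add_one (i : ℤ) : doubleRay.Adj i (i + 1) :=
  doubleRay_adj.2 (Or.inl rfl)

/-- Translation by `k` as an automorphism of the double ray. -/
def doubleRayTranslation (k : ℤ) : doubleRay ≃g doubleRay where
  toEquiv := Equiv.addRight k
  map_rel_iff' := by
    intro a b
    simp only [doubleRay_adj, Equiv.coe_addRight]
    omega

@[simp]
theorem doubleRayTranslation_apply (k i : ℤ) : doubleRayTranslation k i = i + k := rfl

theorem Fin.eq_of_ne_of_ne_three {a b c d : Fin 3} (hab : a ≠ b) (hac : a ≠ c) (hbc : b ≠ c)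
    (hdb : d ≠ b) (hdc : d ≠ c) : a = d := by
  omega

section ThreeColors

variable {cv : ℤ → Fin 3} {ce : Sym2 ℤ → Fin 3}

/-- In a proper total 3-colouring of the double ray, a vertex has the colour of the
edge at distance one to its right. -/
theorem IsProperTotalColoring.vertex_eq_edge_right (h : IsProperTotalColoring doubleRay cv ce)
    (i : ℤ) : cv i = ce s(i + 1, i + 1 + 1) := by
  obtain ⟨hv, he, hve⟩ := h
  have h₀ := doubleRay_adj_add_one i
  have h₁ := doubleRay_adj_add_one (i + 1)
  have hie := he (i + 1) (i + 1 + 1) i h₁ h₀.symm (by omega)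
  rw [Sym2.eq_swap (a := i + 1) (b := i)] at hie
  have hiv := hve _ _ h₀.symm
  rw [Sym2.eq_swap] at hiv
  exact Fin.eq_of_ne_of_ne_three (hv _ _ h₀) (hve _ _ h₀) hiv (hve _ _ h₁).symm hie

/-- In a proper total 3-colouring of the double ray, an edge has the colour of the
vertex at distance one to its right. -/
theorem IsProperTotalColoring.edge_eq_vertex_right (h : IsProperTotalColoring doubleRay cv ce)
    (i : ℤ) : ce s(i, i + 1) = cv (i + 1 + 1) := by
  obtain ⟨hv, he, hve⟩ := h
  have h₀ := doubleRay_adj_add_one i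
  have h₁ := doubleRay_adj_add_one (i + 1)
  have hie := he (i + 1) i (i + 1 + 1) h₀.symm h₁ (by omega)
  rw [Sym2.eq_swap (a := i + 1) (b := i)] at hie
  have hiv := hve _ _ h₀.symm
  rw [Sym2.eq_swap] at hiv
  have hv₂ := hve _ _ h₁.symm
  rw [Sym2.eq_swap] at hv₂
  exact Fin.eq_of_ne_of_ne_three hiv.symm hie (hve _ _ h₁) (hv _ _ h₁.symm) hv₂

theorem IsProperTotalColoring.vertex_add_three (h : IsProperTotalColoring doubleRay cv ce)
    (i : ℤ) : cv (i + 3) = cv i := by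
  rw [h.vertex_eq_edge_right i, h.edge_eq_vertex_right (i + 1)]
  congr 1
  omega

theorem IsProperTotalColoring.edge_add_three (h : IsProperTotalColoring doubleRay cv ce)
    (i : ℤ) : ce s(i + 3, i + 1 + 3) = ce s(i, i + 1) := by
  rw [h.edge_eq_vertex_right i, h.vertex_eq_edge_right (i + 1 + 1)]
  congr 2 <;> omega

theorem IsProperTotalColoring.edge_translation_three
    (h : IsProperTotalColoring doubleRay cv ce) {u v : ℤ} (huv : doubleRay.Adj u v) :
    ce s(u + 3, v + 3) = ce s(u, v) := by
  rcases doubleRay_adj.1 huv with rfl | rfl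
  · exact h.edge_add_three u
  · rw [Sym2.eq_swap, h.edge_add_three v, Sym2.eq_swap]

end ThreeColors

/-- An automorphism preserving a proper total colouring fixes every neighbour of a fixed
vertex. -/
theorem IsProperTotalColoring.fixes_neighbor {V α : Type*} {G : SimpleGraph V} {cv : V → α}
    {ce : Sym2 V → α} (h : IsProperTotalColoring G cv ce) {φ : G ≃g G}
    (hφ : ∀ u v, G.Adj u v → ce s(φ u, φ v) = ce s(u, v)) {u v : V} (huv : G.Adj u v)
    (hu : φ u = u) : φ v = v := by
  by_contra hne
  have hadj := φ.map_adj_iff.2 huv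
  have hce := hφ u v huv
  rw [hu] at hadj hce
  exact h.2.1 u (φ v) v hadj huv hne hce

/-- A proper total colouring of the double ray is distinguishing if the colour of vertex `0`
is used on no other vertex. -/
theorem IsProperTotalColoring.isDistinguishing_of_unique {α : Type*} {cv : ℤ → α}
    {ce : Sym2 ℤ → α} (h : IsProperTotalColoring doubleRay cv ce)
    (h₀ : ∀ i, cv i = cv 0 → i = 0) : IsDistinguishingTotalColoring doubleRay cv ce := by
  rintro φ ⟨hv, he⟩ i
  induction i using Int.induction_on with
  | zero => exact h₀ _ (hv 0)
  | succ n ih => exact h.fixes_neighbor he (doubleRay_adj_add_one _) ih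
  | pred n ih => exact h.fixes_neighbor he (doubleRay_adj.2 (Or.inr (by omega))) ih

/-- The residue modulo `3`, as one of the first three of four colours. -/
def residueColor (n : ℤ) : Fin 4 :=
  if n % 3 = 0 then 0 else if n % 3 = 1 then 1 else 2

theorem residueColor_eq_iff {m n : ℤ} : residueColor m = residueColor n ↔ m % 3 = n % 3 := by
  unfold residueColor
  split_ifs <;> simp <;> omega

theorem residueColor_ne_three (n : ℤ) : residueColor n ≠ 3 := by
  unfold residueColor
  split_ifs <;> decide

/-- The periodic vertex 3-colouring of the double ray, with vertex `0` recoloured by a fourth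
colour. -/
def markedVertexColor (i : ℤ) : Fin 4 := if i = 0 then 3 else residueColor (2 * i)

/-- The edge colouring giving `ij` the residue of `i + j` modulo `3`. -/
def sumEdgeColor : Sym2 ℤ → Fin 4 :=
  Sym2.lift ⟨fun i j => residueColor (i + j), fun i j => congrArg residueColor (add_comm i j)⟩

@[simp]
theorem sumEdgeColor_mk (i j : ℤ) : sumEdgeColor s(i, j) = residueColor (i + j) := rfl

theorem isProperTotalColoring_marked :
    IsProperTotalColoring doubleRay markedVertexColor sumEdgeColor := by
  refine ⟨fun u v huv => ?_, fun u v w huv huw hvw => ?_, fun u v huv => ?_⟩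
  · rw [doubleRay_adj] at huv
    unfold markedVertexColor
    split_ifs
    · omega
    · exact (residueColor_ne_three _).symm
    · exact residueColor_ne_three _
    · rw [Ne, residueColor_eq_iff]
      omega
  · rw [doubleRay_adj] at huv huw
    rw [sumEdgeColor_mk, sumEdgeColor_mk, Ne, residueColor_eq_iff]
    omega
  · rw [doubleRay_adj] at huv
    rw [sumEdgeColor_mk]
    unfold markedVertexColor
    split_ifs
    · exact (residueColor_ne_three _).symm
    · rw [Ne, residueColor_eq_iff]
      omega

theorem eq_zero_of_markedVertexColor_eq {i : ℤ}
    (h : markedVertexColor i = markedVertexColor 0) : i = 0 := by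
  by_contra hi
  simp only [markedVertexColor, hi, if_false, if_true] at h
  exact residueColor_ne_three _ h

/-- Every proper total 3-colouring of the double ray is preserved by a non-identity
automorphism; consequently `χ''_D(P_∞) = χ''(P_∞) + 1 = 4`, as witnessed by a proper
distinguishing total 4-colouring. -/
theorem doubleRay_totalDistinguishingChromaticNumber_eq_four :
    (∀ (cv : ℤ → Fin 3) (ce : Sym2 ℤ → Fin 3), IsProperTotalColoring doubleRay cv ce →
      ∃ φ : doubleRay ≃g doubleRay, (∃ v, φ v ≠ v) ∧ (∀ v, cv (φ v) = cv v) ∧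
        ∀ u v, doubleRay.Adj u v → ce s(φ u, φ v) = ce s(u, v)) ∧
    (∃ (cv : ℤ → Fin 4) (ce : Sym2 ℤ → Fin 4),
      IsProperTotalColoring doubleRay cv ce ∧
      IsDistinguishingTotalColoring doubleRay cv ce) := by
  refine ⟨fun cv ce h => ⟨doubleRayTranslation 3, ⟨0, by simp⟩, h.vertex_add_three,
    fun u v huv => h.edge_translation_three huv⟩, markedVertexColor, sumEdgeColor,
    isProperTotalColoring_marked,
    isProperTotalColoring_marked.isDistinguishing_of_unique
      fun _ => eq_zero_of_markedVertexColor_eq⟩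
end

section
/- Every connected infinite simple graph in which every vertex has degree at most 2 is isomorphic either to the ray (the graph on ℕ with n adjacent to n+1 for all n) or to the double ray (the graph on ℤ with i adjacent to i+1 for all i). -/
open SimpleGraph

/-- The ray: the graph on `ℕ` with `n` adjacent to `m` iff `|n - m| = 1`. -/
def rayGraph : SimpleGraph ℕ := SimpleGraph.fromRel (fun m n => n = m + 1)

namespace SimpleGraph

variable {V : Type*} {G : SimpleGraph V}

theorem eq_or_eq_of_adj_of_ncard_neighborSet_le_two {v a b c : V}
    (hfin : (G.neighborSet v).Finite) (hcard : (G.neighborSet v).ncard ≤ 2)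
    (ha : G.Adj v a) (hb : G.Adj v b) (hab : a ≠ b) (hc : G.Adj v c) : c = a ∨ c = b := by
  by_contra! hne
  have hsub : ({a, b, c} : Set V) ⊆ G.neighborSet v := by
    rintro x (rfl | rfl | rfl) <;> assumption
  have hle := Set.ncard_le_ncard hsub hfin
  rw [Set.ncard_eq_three.2 ⟨a, b, c, hab, hne.1.symm, hne.2.symm, rfl⟩] at hle
  omega

theorem Connected.exists_adj_dist_eq_of_dist_eq_succ (hG : G.Connected) {u w : V} {n : ℕ}
    (h : G.dist u w = n + 1) : ∃ x, G.Adj x w ∧ G.dist u x = n := by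
  obtain ⟨p, hp⟩ := hG.exists_walk_length_eq_dist w u
  rw [dist_comm, h] at hp
  cases p with
  | nil => simp at hp
  | @cons _ x _ hadj q =>
    refine ⟨x, hadj.symm, ?_⟩
    have hq : G.dist x u ≤ n := (dist_le q).trans (by simpa using hp.le)
    have htri := hG.dist_triangle (u := u) (v := x) (w := w)
    rw [dist_eq_one_iff_adj.2 hadj.symm] at htri
    rw [dist_comm] at hq
    omega

theorem Connected.eq_univ_of_adj_closed (hG : G.Connected) {S : Set V} (hS : S.Nonempty)
    (hclosed : ∀ u w, u ∈ S → G.Adj u w → w ∈ S) : S = Set.univ := by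
  obtain ⟨u, hu⟩ := hS
  refine Set.eq_univ_of_forall fun w => ?_
  obtain ⟨p⟩ := hG.preconnected u w
  induction p with
  | nil => exact hu
  | cons h _ ih => exact ih (hclosed _ _ hu h)

/-- In a connected graph of maximum degree two, the distance from a vertex with at most one
neighbour separates vertices. -/
theorem Connected.dist_injective_of_subsingleton_neighborSet (hG : G.Connected)
    (h2 : ∀ v a b c, G.Adj v a → G.Adj v b → a ≠ b → G.Adj v c → c = a ∨ c = b)
    {v₀ : V} (hv : ∀ a b, G.Adj v₀ a → G.Adj v₀ b → a = b) :
    Function.Injective (G.dist v₀) := by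
  have key : ∀ n x y, G.dist v₀ x = n → G.dist v₀ y = n → x = y := by
    intro n
    induction n with
    | zero =>
      intro x y hx hy
      rw [hG.dist_eq_zero_iff] at hx hy
      rw [← hx, ← hy]
    | succ n ih =>
      intro x y hx hy
      obtain ⟨x', hxx', hx'⟩ := hG.exists_adj_dist_eq_of_dist_eq_succ hx
      obtain ⟨y', hyy', hy'⟩ := hG.exists_adj_dist_eq_of_dist_eq_succ hy
      obtain rfl := ih x' y' hx' hy'
      cases n with
      | zero =>
        rw [hG.dist_eq_zero_iff] at hx'
        subst hx'
        exact hv x y hxx' hyy'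
      | succ m =>
        obtain ⟨z, hz, hzd⟩ := hG.exists_adj_dist_eq_of_dist_eq_succ hx'
        have hne : ∀ t, G.dist v₀ t = m + 1 + 1 → z ≠ t := by
          rintro t ht rfl
          omega
        rcases h2 x' z x y hz.symm hxx' (hne x hx) hyy' with h | h
        · exact absurd h.symm (hne y hy)
        · exact h.symm
  exact fun x y hxy => key _ x y hxy rfl

theorem Connected.dist_surjective_of_injective [Infinite V] (hG : G.Connected) {v₀ : V}
    (hinj : Function.Injective (G.dist v₀)) : Function.Surjective (G.dist v₀) := by
  have down : ∀ n k w, G.dist v₀ w = n + k → ∃ x, G.dist v₀ x = n := by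
    intro n k
    induction k with
    | zero => exact fun w hw => ⟨w, hw⟩
    | succ k ih =>
      intro w hw
      obtain ⟨x, -, hx⟩ := hG.exists_adj_dist_eq_of_dist_eq_succ hw
      exact ih x hx
  intro n
  obtain ⟨_, ⟨w, rfl⟩, hm⟩ := (Set.infinite_range_of_injective hinj).exists_gt n
  exact down n (G.dist v₀ w - n) w (by omega)

theorem Connected.nonempty_iso_rayGraph_of_dist_bijective (hG : G.Connected) {v₀ : V}
    (hbij : Function.Bijective (G.dist v₀)) : Nonempty (G ≃g rayGraph) := by
  have hsucc : ∀ x y, G.dist v₀ y = G.dist v₀ x + 1 → G.Adj x y := by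
    intro x y h
    obtain ⟨z, hz, hzd⟩ := hG.exists_adj_dist_eq_of_dist_eq_succ h
    exact hbij.1 hzd ▸ hz
  refine ⟨⟨Equiv.ofBijective _ hbij, ?_⟩⟩
  intro x y
  simp only [rayGraph, fromRel_adj, Equiv.ofBijective_apply]
  constructor
  · rintro ⟨-, h | h⟩
    · exact hsucc x y h
    · exact (hsucc y x h).symm
  · intro h
    have hne : G.dist v₀ x ≠ G.dist v₀ y := fun he => h.ne (hbij.1 he)
    have h₁ := hG.dist_triangle (u := v₀) (v := x) (w := y)
    have h₂ := hG.dist_triangle (u := v₀) (v := y) (w := x)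
    rw [dist_eq_one_iff_adj.2 h] at h₁
    rw [dist_eq_one_iff_adj.2 h.symm] at h₂
    omega

/-- If every vertex has exactly two neighbours, there is a bi-infinite non-backtracking walk. -/
theorem exists_int_nonbacktracking [Nonempty V]
    (h2 : ∀ v a b c, G.Adj v a → G.Adj v b → a ≠ b → G.Adj v c → c = a ∨ c = b)
    (hex : ∀ v, ∃ a b, G.Adj v a ∧ G.Adj v b ∧ a ≠ b) :
    ∃ f : ℤ → V, (∀ n, G.Adj (f n) (f (n + 1))) ∧ ∀ n, f n ≠ f (n + 2) := by
  have hother : ∀ u v, ∃ w, G.Adj v w ∧ w ≠ u := by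
    intro u v
    obtain ⟨a, b, ha, hb, hab⟩ := hex v
    by_cases hau : a = u
    · exact ⟨b, hb, fun h => hab (hau.trans h.symm)⟩
    · exact ⟨a, ha, hau⟩
  choose o hadj hne using hother
  have huniq : ∀ u v, G.Adj v u → o (o u v) v = u := by
    intro u v huv
    rcases h2 v (o u v) u _ (hadj u v) huv (hne u v) (hadj (o u v) v) with h | h
    · exact absurd h (hne _ _)
    · exact h
  let σ : Equiv.Perm G.Dart :=
    { toFun := fun d => ⟨(d.snd, o d.fst d.snd), hadj _ _⟩
      invFun := fun d => ⟨(o d.snd d.fst, d.fst), (hadj _ _).symm⟩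
      left_inv := fun d => by
        apply Dart.ext
        exact Prod.ext (huniq d.fst d.snd d.adj.symm) rfl
      right_inv := fun d => by
        apply Dart.ext
        exact Prod.ext rfl (huniq d.snd d.fst d.adj) }
  have hfst : ∀ d, (σ d).fst = d.snd := fun _ => rfl
  have hsnd : ∀ d, (σ d).snd = o d.fst d.snd := fun _ => rfl
  obtain ⟨v⟩ := ‹Nonempty V›
  obtain ⟨a, -, ha, -, -⟩ := hex v
  let d : G.Dart := ⟨(v, a), ha⟩
  have hstep : ∀ n : ℤ, (σ ^ (n + 1)) d = σ ((σ ^ n) d) := by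
    intro n
    rw [add_comm, zpow_add, zpow_one, Equiv.Perm.mul_apply]
  refine ⟨fun n => ((σ ^ n) d).fst, fun n => ?_, fun n => ?_⟩
  · simp only [hstep, hfst]
    exact ((σ ^ n) d).adj
  · have htwo : n + 2 = n + 1 + 1 := by ring
    simp only [htwo, hstep, hfst, hsnd]
    exact (hne _ _).symm

theorem Connected.nonempty_iso_doubleRay_of_nonbacktracking [Infinite V] (hG : G.Connected)
    (h2 : ∀ v a b c, G.Adj v a → G.Adj v b → a ≠ b → G.Adj v c → c = a ∨ c = b)
    {f : ℤ → V} (hadj : ∀ n, G.Adj (f n) (f (n + 1))) (hne : ∀ n, f n ≠ f (n + 2)) :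
    Nonempty (G ≃g doubleRay) := by
  have hadj' : ∀ n, G.Adj (f n) (f (n - 1)) := fun n => by
    simpa using (hadj (n - 1)).symm
  have hne' : ∀ n, f (n - 1) ≠ f (n + 1) := fun n => by
    have h := hne (n - 1)
    rwa [show n - 1 + 2 = n + 1 by ring] at h
  have hnbr : ∀ n w, G.Adj (f n) w → w = f (n - 1) ∨ w = f (n + 1) := fun n w hw =>
    h2 _ _ _ _ (hadj' n) (hadj n) (hne' n) hw
  have hsurj : Function.Surjective f := by
    rw [← Set.range_eq_univ]
    refine hG.eq_univ_of_adj_closed (Set.range_nonempty f) ?_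
    rintro _ w ⟨n, rfl⟩ hw
    rcases hnbr n w hw with rfl | rfl <;> exact Set.mem_range_self _
  have hreflect : ∀ i j, f i = f j → f (i + 1) = f (j - 1) →
      ∀ k : ℕ, f (i + k) = f (j - k) ∧ f (i + k + 1) = f (j - k - 1) := by
    intro i j h₀ h₁ k
    induction k with
    | zero => simpa using ⟨h₀, h₁⟩
    | succ k ih =>
      have e₁ : i + ((k + 1 : ℕ) : ℤ) = i + k + 1 := by push_cast; ring
      have e₂ : j - ((k + 1 : ℕ) : ℤ) = j - k - 1 := by push_cast; ring
      rw [e₁, e₂]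
      refine ⟨ih.2, ?_⟩
      have hw := hadj (i + k + 1)
      rw [ih.2] at hw
      rcases hnbr _ _ hw with h | h
      · exact h
      · rw [sub_add_cancel, ← ih.1] at h
        exact absurd h.symm (by simpa [add_assoc] using hne (i + k))
  have hinj_lt : ∀ i j, i < j → f i ≠ f j := by
    intro i j hij h
    have hw := hadj i
    rw [h] at hw
    rcases hnbr _ _ hw with h₁ | h₁
    · obtain ⟨m, hm⟩ := Int.eq_ofNat_of_zero_le (show 0 ≤ (j - i - 1) / 2 by omega)
      have hr := hreflect i j h h₁ m
      rcases Int.even_or_odd' (j - i) with ⟨c, hc | hc⟩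
      · have hj : j - m = i + m + 2 := by omega
        exact hne (i + m) (hr.1.trans (by rw [hj]))
      · have hj : j - m = i + m + 1 := by omega
        exact (hadj (i + m)).ne (hr.1.trans (by rw [hj]))
    · have hback : f (i - 1) = f (j - 1) := by
        have hw' := hadj' i
        rw [h] at hw'
        rcases hnbr _ _ hw' with h' | h'
        · exact h'
        · exact absurd (h'.trans h₁.symm) (hne' i)
      have huniv : f '' Set.Ico i j = Set.univ := by
        refine hG.eq_univ_of_adj_closed ⟨f i, i, ⟨le_rfl, hij⟩, rfl⟩ ?_
        rintro _ w ⟨n, ⟨hin, hnj⟩, rfl⟩ hw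
        rcases hnbr n w hw with rfl | rfl
        · by_cases hn : n = i
          · exact ⟨j - 1, ⟨by omega, by omega⟩, by rw [hn, hback]⟩
          · exact ⟨n - 1, ⟨by omega, by omega⟩, rfl⟩
        · by_cases hn : n + 1 = j
          · exact ⟨i, ⟨le_rfl, hij⟩, by rw [hn, h]⟩
          · exact ⟨n + 1, ⟨by omega, by omega⟩, rfl⟩
      exact Set.infinite_univ (huniv ▸ (Set.finite_Ico i j).image f)
  have hinj : Function.Injective f := by
    intro i j h
    rcases lt_trichotomy i j with hij | hij | hij
    · exact absurd h (hinj_lt i j hij)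
    · exact hij
    · exact absurd h.symm (hinj_lt j i hij)
  refine ⟨RelIso.symm ⟨Equiv.ofBijective f ⟨hinj, hsurj⟩, ?_⟩⟩
  intro i j
  simp only [doubleRay, fromRel_adj]
  constructor
  · intro h
    rcases hnbr _ _ h with h' | h' <;> have := hinj h' <;> omega
  · rintro ⟨-, rfl | rfl⟩
    · exact hadj _
    · exact (hadj _).symm

end SimpleGraph

/-- Every connected infinite graph with all degrees at most 2 is isomorphic to the ray
or to the double ray. -/
theorem connected_infinite_maxDegree_two_iso_ray_or_doubleRay
    {V : Type*} [Infinite V] (G : SimpleGraph V) (hG : G.Connected)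
    (hdeg : ∀ v, (G.neighborSet v).Finite ∧ (G.neighborSet v).ncard ≤ 2) :
    Nonempty (G ≃g rayGraph) ∨ Nonempty (G ≃g doubleRay) := by
  have h2 : ∀ v a b c, G.Adj v a → G.Adj v b → a ≠ b → G.Adj v c → c = a ∨ c = b :=
    fun v _ _ _ => eq_or_eq_of_adj_of_ncard_neighborSet_le_two (hdeg v).1 (hdeg v).2
  by_cases hleaf : ∃ v₀, ∀ a b, G.Adj v₀ a → G.Adj v₀ b → a = b
  · obtain ⟨v₀, hv⟩ := hleaf
    have hinj := hG.dist_injective_of_subsingleton_neighborSet h2 hv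
    exact Or.inl (hG.nonempty_iso_rayGraph_of_dist_bijective
      ⟨hinj, hG.dist_surjective_of_injective hinj⟩)
  · push Not at hleaf
    obtain ⟨f, hadj, hne⟩ := exists_int_nonbacktracking h2 hleaf
    exact Or.inr (hG.nonempty_iso_doubleRay_of_nonbacktracking h2 hadj hne)
end

section
/- Let Δ ≥ 3 be a natural number and let G be the infinite graph consisting of a star K_{1,Δ} in which one edge is subdivided into a ray: G has a central vertex c adjacent to Δ − 1 leaves and to the first vertex of an infinite ray attached at c. Then the distinguishing chromatic number of G equals Δ: G admits a proper vertex Δ-colouring preserved only by the identity automorphism, and no proper vertex colouring with fewer than Δ colours is preserved only by the identity automorphism. -/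
open SimpleGraph

/-- The star `K_{1,Δ}` with one edge subdivided into a ray: the centre `Sum.inl ()` is
adjacent to `Δ - 1` leaves `Sum.inr (Sum.inl i)` and to the origin `Sum.inr (Sum.inr 0)`
of a ray `Sum.inr (Sum.inr n)`, `n ∈ ℕ`. -/
def starRay (Δ : ℕ) : SimpleGraph (Unit ⊕ (Fin (Δ - 1) ⊕ ℕ)) :=
  SimpleGraph.fromRel (fun x y =>
    (∃ i : Fin (Δ - 1), x = Sum.inl () ∧ y = Sum.inr (Sum.inl i)) ∨
    (x = Sum.inl () ∧ y = Sum.inr (Sum.inr 0)) ∨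
    (∃ n : ℕ, x = Sum.inr (Sum.inr n) ∧ y = Sum.inr (Sum.inr (n + 1))))

@[simp] theorem starRay_adj_center_center (Δ : ℕ) (u v : Unit) :
    ¬ (starRay Δ).Adj (Sum.inl u) (Sum.inl v) := by
  simp [starRay]

@[simp] theorem starRay_adj_center_leaf (Δ : ℕ) (u : Unit) (i : Fin (Δ - 1)) :
    (starRay Δ).Adj (Sum.inl u) (Sum.inr (Sum.inl i)) := by
  simp [starRay]

@[simp] theorem starRay_adj_center_ray (Δ : ℕ) (u : Unit) (n : ℕ) :
    (starRay Δ).Adj (Sum.inl u) (Sum.inr (Sum.inr n)) ↔ n = 0 := by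
  simp [starRay]

@[simp] theorem starRay_adj_leaf_center (Δ : ℕ) (u : Unit) (i : Fin (Δ - 1)) :
    (starRay Δ).Adj (Sum.inr (Sum.inl i)) (Sum.inl u) := by
  simp [starRay]

@[simp] theorem starRay_adj_leaf_inr (Δ : ℕ) (i : Fin (Δ - 1)) (x : Fin (Δ - 1) ⊕ ℕ) :
    ¬ (starRay Δ).Adj (Sum.inr (Sum.inl i)) (Sum.inr x) := by
  simp [starRay]

@[simp] theorem starRay_adj_ray_center (Δ : ℕ) (u : Unit) (n : ℕ) :
    (starRay Δ).Adj (Sum.inr (Sum.inr n)) (Sum.inl u) ↔ n = 0 := by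
  simp [starRay]

@[simp] theorem starRay_adj_ray_leaf (Δ : ℕ) (i : Fin (Δ - 1)) (n : ℕ) :
    ¬ (starRay Δ).Adj (Sum.inr (Sum.inr n)) (Sum.inr (Sum.inl i)) := by
  simp [starRay]

@[simp] theorem starRay_adj_ray_ray (Δ m n : ℕ) :
    (starRay Δ).Adj (Sum.inr (Sum.inr m)) (Sum.inr (Sum.inr n)) ↔ n = m + 1 ∨ m = n + 1 := by
  simp only [starRay, SimpleGraph.fromRel_adj, ne_eq, Sum.inr.injEq, reduceCtorEq, false_and,
    exists_false, false_or, ↓existsAndEq, true_and]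
  grind

/-- The automorphism of `starRay Δ` induced by a permutation of the leaves. -/
def starRayPermLeaves (Δ : ℕ) (σ : Equiv.Perm (Fin (Δ - 1))) : starRay Δ ≃g starRay Δ where
  toEquiv := Equiv.sumCongr (Equiv.refl _) (Equiv.sumCongr σ (Equiv.refl _))
  map_rel_iff' := by
    rintro (u | i | m) (v | j | n) <;> simp

/-- The colouring of `starRay Δ` with centre `0`, leaves `1, …, Δ - 1`, and ray alternating
between `1` and `0`. -/
def starRayColoring (Δ : ℕ) (hΔ : 3 ≤ Δ) : Unit ⊕ (Fin (Δ - 1) ⊕ ℕ) → Fin Δ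
  | Sum.inl _ => ⟨0, by omega⟩
  | Sum.inr (Sum.inl i) => ⟨i + 1, by omega⟩
  | Sum.inr (Sum.inr n) => ⟨(n + 1) % 2, by omega⟩

theorem starRayColoring_isProper (Δ : ℕ) (hΔ : 3 ≤ Δ) :
    IsProperVertexColoring (starRay Δ) (starRayColoring Δ hΔ) := by
  rintro (u | i | m) (v | j | n) h <;> simp [starRayColoring] at h ⊢ <;> omega

theorem starRayColoring_isDistinguishing (Δ : ℕ) (hΔ : 3 ≤ Δ) :
    IsDistinguishingVertexColoring (starRay Δ) (starRayColoring Δ hΔ) := by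
  intro φ hφ
  have adj {u v} (h : (starRay Δ).Adj u v) : (starRay Δ).Adj (φ u) (φ v) :=
    φ.map_adj_iff.2 h
  have center : φ (Sum.inl ()) = Sum.inl () := by
    have hc := hφ (Sum.inl ())
    have hl := hφ (Sum.inr (Sum.inl ⟨1, by omega⟩))
    have h := adj (starRay_adj_center_leaf Δ () ⟨1, by omega⟩)
    rcases hx : φ (Sum.inl ()) with _ | i | m
    · rfl
    · simp [hx, starRayColoring] at hc
    · rcases hy : φ (Sum.inr (Sum.inl ⟨1, by omega⟩)) with _ | j | n
      · simp [hy, starRayColoring] at hl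
      · simp [hx, hy] at h
      · simp [hy, starRayColoring] at hl
        omega
  have leaf (i : Fin (Δ - 1)) : φ (Sum.inr (Sum.inl i)) = Sum.inr (Sum.inl i) := by
    have hl := hφ (Sum.inr (Sum.inl i))
    have h := adj (starRay_adj_center_leaf Δ () i)
    rw [center] at h
    rcases hx : φ (Sum.inr (Sum.inl i)) with _ | j | n
    · simp [hx] at h
    · simpa [hx, starRayColoring, Fin.ext_iff] using hl
    · obtain rfl : n = 0 := by simpa [hx] using h
      obtain ⟨v, hv⟩ := φ.surjective (Sum.inr (Sum.inr 1))
      have hadj : (starRay Δ).Adj (φ (Sum.inr (Sum.inl i))) (φ v) := by simp [hx, hv]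
      rw [φ.map_adj_iff] at hadj
      rcases v with _ | v
      · simp [center] at hv
      · simp at hadj
  have ray (n : ℕ) : φ (Sum.inr (Sum.inr n)) = Sum.inr (Sum.inr n) := by
    induction n using Nat.strong_induction_on with
    | _ n ih =>
      rcases hx : φ (Sum.inr (Sum.inr n)) with _ | j | m
      · exact absurd (φ.injective (hx.trans center.symm)) (by simp)
      · exact absurd (φ.injective (hx.trans (leaf j).symm)) (by simp)
      · have hm : ¬ m < n := fun hlt => by
          have := φ.injective (hx.trans (ih m hlt).symm)
          simp at this
          omega
        rcases n with _ | n
        · have h := adj ((starRay_adj_center_ray Δ () 0).2 rfl)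
          simpa [center, hx] using h
        · have h := adj ((starRay_adj_ray_ray Δ n (n + 1)).2 (Or.inl rfl))
          rw [ih n n.lt_succ_self, hx, starRay_adj_ray_ray] at h
          simp only [Sum.inr.injEq]
          omega
  rintro (_ | i | n)
  exacts [center, leaf i, ray n]

/-- In a distinguishing colouring of `starRay Δ`, the leaves have distinct colours. -/
theorem IsDistinguishingVertexColoring.injective_leaf {Δ : ℕ} {α : Type*}
    {c : Unit ⊕ (Fin (Δ - 1) ⊕ ℕ) → α} (hc : IsDistinguishingVertexColoring (starRay Δ) c) :
    Function.Injective fun i : Fin (Δ - 1) => c (Sum.inr (Sum.inl i)) := by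
  intro i j hij
  have h := hc (starRayPermLeaves Δ (Equiv.swap i j)) (by
    rintro (_ | l | n)
    · rfl
    · change c (Sum.inr (Sum.inl (Equiv.swap i j l))) = _
      rw [Equiv.swap_apply_def]
      split_ifs with h₁ h₂
      · rw [h₁]; exact hij.symm
      · rw [h₂]; exact hij
      · rfl
    · rfl) (Sum.inr (Sum.inl i))
  have h' : (Sum.inr (Sum.inl (Equiv.swap i j i)) : Unit ⊕ (Fin (Δ - 1) ⊕ ℕ)) =
    Sum.inr (Sum.inl i) := h
  simpa using h'.symm

/-- For `Δ ≥ 3`, the star `K_{1,Δ}` with one edge subdivided into a ray has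
distinguishing chromatic number exactly `Δ`. -/
theorem starRay_distinguishingChromaticNumber_eq (Δ : ℕ) (hΔ : 3 ≤ Δ) :
    (∃ c : (Unit ⊕ (Fin (Δ - 1) ⊕ ℕ)) → Fin Δ,
      IsProperVertexColoring (starRay Δ) c ∧
      IsDistinguishingVertexColoring (starRay Δ) c) ∧
    (∀ k : ℕ, k < Δ →
      ¬ ∃ c : (Unit ⊕ (Fin (Δ - 1) ⊕ ℕ)) → Fin k,
        IsProperVertexColoring (starRay Δ) c ∧
        IsDistinguishingVertexColoring (starRay Δ) c) := by
  refine ⟨⟨starRayColoring Δ hΔ, starRayColoring_isProper Δ hΔ,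
    starRayColoring_isDistinguishing Δ hΔ⟩, ?_⟩
  rintro k hk ⟨c, hproper, hdist⟩
  have hinj : Function.Injective fun x : Unit ⊕ Fin (Δ - 1) =>
      c (Sum.map id Sum.inl x) := by
    rintro (u | i) (v | j) h
    · rfl
    · exact absurd h (hproper _ _ (starRay_adj_center_leaf Δ u j))
    · exact absurd h (hproper _ _ (starRay_adj_leaf_center Δ v i))
    · exact congrArg Sum.inr (hdist.injective_leaf h)
  have hcard := Fintype.card_le_of_injective _ hinj
  simp at hcard
  omega
end

section
/- Let Δ ≥ 3 be a natural number and let G be the infinite graph obtained from the complete bipartite graph K_{Δ,Δ} by deleting one edge uv and attaching a ray at u and a ray at v. Then G is a connected infinite graph with maximum degree Δ and its distinguishing chromatic number equals 2Δ − 2. -/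
open SimpleGraph

/-- The graph obtained from `K_{Δ,Δ}` with parts `A = {a₀, …}` (encoded
`Sum.inl (Sum.inl i)`) and `B = {b₀, …}` (encoded `Sum.inl (Sum.inr j)`) by deleting the
edge `a₀b₀` and attaching a ray `Sum.inr (Sum.inl n)` at `a₀` and a ray
`Sum.inr (Sum.inr n)` at `b₀`. -/
def bipRay (Δ : ℕ) : SimpleGraph ((Fin Δ ⊕ Fin Δ) ⊕ (ℕ ⊕ ℕ)) :=
  SimpleGraph.fromRel (fun x y =>
    (∃ i j : Fin Δ, ¬((i : ℕ) = 0 ∧ (j : ℕ) = 0) ∧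
      x = Sum.inl (Sum.inl i) ∧ y = Sum.inl (Sum.inr j)) ∨
    (∃ i : Fin Δ, (i : ℕ) = 0 ∧ x = Sum.inl (Sum.inl i) ∧ y = Sum.inr (Sum.inl 0)) ∨
    (∃ n : ℕ, x = Sum.inr (Sum.inl n) ∧ y = Sum.inr (Sum.inl (n + 1))) ∨
    (∃ j : Fin Δ, (j : ℕ) = 0 ∧ x = Sum.inl (Sum.inr j) ∧ y = Sum.inr (Sum.inr 0)) ∨
    (∃ n : ℕ, x = Sum.inr (Sum.inr n) ∧ y = Sum.inr (Sum.inr (n + 1))))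

/-- In a distinguishing colouring, two vertices with the same neighbours have distinct
colours. -/
lemma IsDistinguishingVertexColoring.eq_of_twins {V α : Type*} {G : SimpleGraph V} {c : V → α}
    (hc : IsDistinguishingVertexColoring G c) {x y : V} (hN : ∀ w, G.Adj x w ↔ G.Adj y w)
    (hxy : c x = c y) : x = y := by
  classical
  have hN' : ∀ w, G.Adj w x ↔ G.Adj w y := fun w => by
    rw [G.adj_comm w x, G.adj_comm w y, hN]
  let φ : G ≃g G :=
    { toEquiv := Equiv.swap x y
      map_rel_iff' := by
        intro a b
        simp only [Equiv.swap_apply_def]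
        split_ifs <;> simp_all }
  have h : φ x = x := hc φ (fun v => by
    change c (Equiv.swap x y v) = c v
    rw [Equiv.swap_apply_def]
    split_ifs <;> simp_all) x
  exact (h.symm.trans (Equiv.swap_apply_left x y))

/-- An automorphism fixing `x` and all neighbours of `x` other than `y` also fixes the
neighbour `y`. -/
lemma SimpleGraph.Iso.apply_eq_of_fixes_other_neighbors {V : Type*} {G : SimpleGraph V}
    (φ : G ≃g G) {x y : V} (hx : φ x = x) (hxy : G.Adj x y)
    (h : ∀ w, G.Adj x w → w ≠ y → φ w = w) : φ y = y := by
  by_contra hy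
  have hadj : G.Adj x (φ y) := by
    rw [← hx]
    exact φ.map_adj_iff.2 hxy
  exact hy (φ.injective (h _ hadj hy))

namespace bipRay

variable {Δ : ℕ}

@[simp]
lemma adj_a_a (i j : Fin Δ) : ¬ (bipRay Δ).Adj (.inl (.inl i)) (.inl (.inl j)) := by
  simp [bipRay]

@[simp]
lemma adj_b_b (i j : Fin Δ) : ¬ (bipRay Δ).Adj (.inl (.inr i)) (.inl (.inr j)) := by
  simp [bipRay]

@[simp]
lemma adj_a_b (i j : Fin Δ) : (bipRay Δ).Adj (.inl (.inl i)) (.inl (.inr j)) ↔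
    ¬ ((i : ℕ) = 0 ∧ (j : ℕ) = 0) := by
  simp [bipRay]

@[simp]
lemma adj_a_p (i : Fin Δ) (n : ℕ) : (bipRay Δ).Adj (.inl (.inl i)) (.inr (.inl n)) ↔
    (i : ℕ) = 0 ∧ n = 0 := by
  simp [bipRay]

@[simp]
lemma adj_a_q (i : Fin Δ) (n : ℕ) : ¬ (bipRay Δ).Adj (.inl (.inl i)) (.inr (.inr n)) := by
  simp [bipRay]

@[simp]
lemma adj_b_q (i : Fin Δ) (n : ℕ) : (bipRay Δ).Adj (.inl (.inr i)) (.inr (.inr n)) ↔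
    (i : ℕ) = 0 ∧ n = 0 := by
  simp [bipRay]

@[simp]
lemma adj_b_p (i : Fin Δ) (n : ℕ) : ¬ (bipRay Δ).Adj (.inl (.inr i)) (.inr (.inl n)) := by
  simp [bipRay]

@[simp]
lemma adj_p_p (m n : ℕ) : (bipRay Δ).Adj (.inr (.inl m)) (.inr (.inl n)) ↔
    n = m + 1 ∨ m = n + 1 := by
  simp [bipRay]
  omega

@[simp]
lemma adj_q_q (m n : ℕ) : (bipRay Δ).Adj (.inr (.inr m)) (.inr (.inr n)) ↔
    n = m + 1 ∨ m = n + 1 := by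
  simp [bipRay]
  omega

@[simp]
lemma adj_p_q (m n : ℕ) : ¬ (bipRay Δ).Adj (.inr (.inl m)) (.inr (.inr n)) := by
  simp [bipRay]

@[simp]
lemma adj_b_a (i j : Fin Δ) : (bipRay Δ).Adj (.inl (.inr i)) (.inl (.inl j)) ↔
    ¬ ((j : ℕ) = 0 ∧ (i : ℕ) = 0) := by
  rw [adj_comm, adj_a_b]

@[simp]
lemma adj_p_a (n : ℕ) (i : Fin Δ) : (bipRay Δ).Adj (.inr (.inl n)) (.inl (.inl i)) ↔
    (i : ℕ) = 0 ∧ n = 0 := by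
  rw [adj_comm, adj_a_p]

@[simp]
lemma adj_q_b (n : ℕ) (i : Fin Δ) : (bipRay Δ).Adj (.inr (.inr n)) (.inl (.inr i)) ↔
    (i : ℕ) = 0 ∧ n = 0 := by
  rw [adj_comm, adj_b_q]

@[simp]
lemma adj_q_a (n : ℕ) (i : Fin Δ) : ¬ (bipRay Δ).Adj (.inr (.inr n)) (.inl (.inl i)) := by
  rw [adj_comm]; exact adj_a_q i n

@[simp]
lemma adj_p_b (n : ℕ) (i : Fin Δ) : ¬ (bipRay Δ).Adj (.inr (.inl n)) (.inl (.inr i)) := by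
  rw [adj_comm]; exact adj_b_p i n

@[simp]
lemma adj_q_p (m n : ℕ) : ¬ (bipRay Δ).Adj (.inr (.inr m)) (.inr (.inl n)) := by
  rw [adj_comm]; exact adj_p_q n m

lemma connected (hΔ : 3 ≤ Δ) : (bipRay Δ).Connected := by
  let a (i : Fin Δ) : (Fin Δ ⊕ Fin Δ) ⊕ (ℕ ⊕ ℕ) := .inl (.inl i)
  let b (i : Fin Δ) : (Fin Δ ⊕ Fin Δ) ⊕ (ℕ ⊕ ℕ) := .inl (.inr i)
  let o : Fin Δ := ⟨1, by omega⟩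
  let z : Fin Δ := ⟨0, by omega⟩
  have hb (j) : (bipRay Δ).Reachable (a o) (b j) := Adj.reachable (by simp [a, b, o])
  have ha (i) : (bipRay Δ).Reachable (a o) (a i) :=
    (hb o).trans (Adj.reachable (by simp [a, b, o]))
  rw [connected_iff_exists_forall_reachable]
  refine ⟨a o, ?_⟩
  rintro ((i | j) | (n | n))
  · exact ha i
  · exact hb j
  · induction n with
    | zero => exact (ha z).trans (Adj.reachable (by simp [a, z]))
    | succ n ih => exact ih.trans (Adj.reachable (by simp))
  · induction n with
    | zero => exact (hb z).trans (Adj.reachable (by simp [b, z]))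
    | succ n ih => exact ih.trans (Adj.reachable (by simp))

lemma neighborSet_a (i : Fin Δ) : (bipRay Δ).neighborSet (.inl (.inl i)) =
    Set.range (fun j : Fin Δ =>
      if (i : ℕ) = 0 ∧ (j : ℕ) = 0 then .inr (.inl 0) else .inl (.inr j)) := by
  ext v
  simp only [mem_neighborSet, Set.mem_range]
  constructor
  · rcases v with (j | j) | (n | n)
    · simp
    · intro h
      exact ⟨j, if_neg (by simpa using h)⟩
    · intro h
      obtain ⟨hi, rfl⟩ := (adj_a_p i n).1 h
      exact ⟨i, by simp [hi]⟩
    · simp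
  · rintro ⟨j, rfl⟩
    split_ifs with h
    · simp [h.1]
    · simpa using h

lemma neighborSet_b (i : Fin Δ) : (bipRay Δ).neighborSet (.inl (.inr i)) =
    Set.range (fun j : Fin Δ =>
      if (i : ℕ) = 0 ∧ (j : ℕ) = 0 then .inr (.inr 0) else .inl (.inl j)) := by
  ext v
  simp only [mem_neighborSet, Set.mem_range]
  constructor
  · rcases v with (j | j) | (n | n)
    · intro h
      exact ⟨j, if_neg (by rw [adj_b_a] at h; tauto)⟩
    · simp
    · simp
    · intro h
      obtain ⟨hi, rfl⟩ := (adj_b_q i n).1 h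
      exact ⟨i, by simp [hi]⟩
  · rintro ⟨j, rfl⟩
    split_ifs with h
    · simp [h.1]
    · rw [adj_b_a]; tauto

lemma ncard_neighborSet_inl (v : Fin Δ ⊕ Fin Δ) :
    ((bipRay Δ).neighborSet (.inl v)).ncard = Δ := by
  rcases v with i | i
  · rw [neighborSet_a, ← Set.image_univ, Set.ncard_image_of_injective, Set.ncard_univ,
      Nat.card_fin]
    intro j k h
    dsimp only at h
    split_ifs at h <;> simp_all [Fin.ext_iff]
  · rw [neighborSet_b, ← Set.image_univ, Set.ncard_image_of_injective, Set.ncard_univ,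
      Nat.card_fin]
    intro j k h
    dsimp only at h
    split_ifs at h <;> simp_all [Fin.ext_iff]

lemma exists_neighborSet_inr_subset_pair (hΔ : 0 < Δ) (v : ℕ ⊕ ℕ) :
    ∃ x y, (bipRay Δ).neighborSet (.inr v) ⊆ {x, y} := by
  rcases v with (_ | n) | (_ | n)
  · refine ⟨.inl (.inl ⟨0, hΔ⟩), .inr (.inl 1), ?_⟩
    rintro ((i | j) | (n | n)) <;> simp [Fin.ext_iff]
  · refine ⟨.inr (.inl n), .inr (.inl (n + 2)), ?_⟩
    rintro ((i | j) | (m | m)) <;> simp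
    omega
  · refine ⟨.inl (.inr ⟨0, hΔ⟩), .inr (.inr 1), ?_⟩
    rintro ((i | j) | (n | n)) <;> simp [Fin.ext_iff]
  · refine ⟨.inr (.inr n), .inr (.inr (n + 2)), ?_⟩
    rintro ((i | j) | (m | m)) <;> simp
    omega

lemma finite_neighborSet (hΔ : 0 < Δ) (v) : ((bipRay Δ).neighborSet v).Finite := by
  rcases v with (i | i) | v
  · rw [neighborSet_a]; exact Set.finite_range _
  · rw [neighborSet_b]; exact Set.finite_range _
  · obtain ⟨x, y, h⟩ := exists_neighborSet_inr_subset_pair hΔ v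
    exact (Set.toFinite _).subset h

lemma ncard_neighborSet_inr_le (hΔ : 0 < Δ) (v : ℕ ⊕ ℕ) :
    ((bipRay Δ).neighborSet (.inr v)).ncard ≤ 2 := by
  obtain ⟨x, y, h⟩ := exists_neighborSet_inr_subset_pair hΔ v
  exact (Set.ncard_le_ncard h).trans ((Set.ncard_insert_le x {y}).trans (by simp))

lemma isLeft_apply (hΔ : 3 ≤ Δ) (φ : bipRay Δ ≃g bipRay Δ) (v) : (φ v).isLeft = v.isLeft := by
  have h : ((bipRay Δ).neighborSet (φ v)).ncard = ((bipRay Δ).neighborSet v).ncard :=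
    (Nat.card_congr (φ.mapNeighborSet v)).symm
  rcases v with v | v <;> rcases hw : φ _ with w | w <;> rw [hw] at h
  · rfl
  · have := ncard_neighborSet_inr_le (show 0 < Δ by omega) w
    rw [ncard_neighborSet_inl] at h
    omega
  · have := ncard_neighborSet_inr_le (show 0 < Δ by omega) v
    rw [ncard_neighborSet_inl] at h
    omega
  · rfl

/-- An automorphism preserves the set of core vertices having a neighbour on a ray. -/
lemma exists_adj_inr_apply_iff (hΔ : 3 ≤ Δ) (φ : bipRay Δ ≃g bipRay Δ) (v) :
    (∃ w, (bipRay Δ).Adj (φ v) (.inr w)) ↔ ∃ w, (bipRay Δ).Adj v (.inr w) := by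
  have key (ψ : bipRay Δ ≃g bipRay Δ) (u) (h : ∃ w, (bipRay Δ).Adj u (.inr w)) :
      ∃ w, (bipRay Δ).Adj (ψ u) (.inr w) := by
    obtain ⟨w, hw⟩ := h
    have hl := isLeft_apply hΔ ψ (.inr w)
    have hadj := ψ.map_adj_iff.2 hw
    rcases hx : ψ (.inr w) with x | x
    · simp [hx] at hl
    · exact ⟨x, hx ▸ hadj⟩
  refine ⟨fun h => ?_, key φ v⟩
  simpa using key φ.symm _ h

/-- An automorphism fixing every core vertex is the identity. -/
lemma eq_of_fixes_core (hΔ : 3 ≤ Δ) (φ : bipRay Δ ≃g bipRay Δ)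
    (h : ∀ v, φ (.inl v) = .inl v) (v) : φ v = v := by
  let z : Fin Δ := ⟨0, by omega⟩
  rcases v with v | (n | n)
  · exact h v
  · induction n using Nat.strong_induction_on with
    | _ n ih =>
      rcases n with _ | n
      · refine φ.apply_eq_of_fixes_other_neighbors (h (.inl z)) (by simp [z]) ?_
        rintro (w | (m | m)) hw hne
        · exact h w
        · simp_all
        · simp at hw
      · refine φ.apply_eq_of_fixes_other_neighbors (ih n (by omega)) (by simp) ?_
        rintro (w | (m | m)) hw hne
        · exact h w
        · refine ih m ?_
          simp at hw hne
          omega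
        · simp at hw
  · induction n using Nat.strong_induction_on with
    | _ n ih =>
      rcases n with _ | n
      · refine φ.apply_eq_of_fixes_other_neighbors (h (.inr z)) (by simp [z]) ?_
        rintro (w | (m | m)) hw hne
        · exact h w
        · simp at hw
        · simp_all
      · refine φ.apply_eq_of_fixes_other_neighbors (ih n (by omega)) (by simp) ?_
        rintro (w | (m | m)) hw hne
        · exact h w
        · simp at hw
        · refine ih m ?_
          simp at hw hne
          omega

/-- A colouring with colours below `2Δ - 2`: `aᵢ` gets `i - 1` and `bᵢ` gets `Δ - 1 + (i - 1)`
(truncated subtraction), and the rays alternate between the colours of `a₀` and `b₀`. -/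
def coloring (Δ : ℕ) : (Fin Δ ⊕ Fin Δ) ⊕ (ℕ ⊕ ℕ) → ℕ
  | .inl (.inl i) => i - 1
  | .inl (.inr i) => Δ - 1 + (i - 1)
  | .inr (.inl n) => if n % 2 = 0 then Δ - 1 else 0
  | .inr (.inr n) => if n % 2 = 0 then 0 else Δ - 1

lemma coloring_lt (hΔ : 3 ≤ Δ) (v) : coloring Δ v < 2 * Δ - 2 := by
  rcases v with (i | i) | (n | n) <;> simp only [coloring]
  · omega
  · omega
  · split_ifs <;> omega
  · split_ifs <;> omega

lemma isProper_coloring (hΔ : 3 ≤ Δ) : IsProperVertexColoring (bipRay Δ) (coloring Δ) := by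
  rintro ((i | i) | (n | n)) ((j | j) | (m | m)) h <;> simp at h <;> simp only [coloring] <;>
    first | omega | (split_ifs <;> omega)

lemma isDistinguishing_coloring (hΔ : 3 ≤ Δ) :
    IsDistinguishingVertexColoring (bipRay Δ) (coloring Δ) := by
  intro φ hφ
  refine eq_of_fixes_core hΔ φ fun v => ?_
  have hc := hφ (.inl v)
  have hl := isLeft_apply hΔ φ (.inl v)
  have hr := exists_adj_inr_apply_iff hΔ φ (.inl v)
  rcases hw : φ (.inl v) with w | w
  · rw [hw] at hc hr
    rcases v with i | i <;> rcases w with j | j <;> simp [coloring] at hc hr ⊢ <;> omega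
  · simp [hw] at hl

lemma two_mul_sub_two_le {k : ℕ} {c : (Fin Δ ⊕ Fin Δ) ⊕ (ℕ ⊕ ℕ) → Fin k}
    (hp : IsProperVertexColoring (bipRay Δ) c) (hd : IsDistinguishingVertexColoring (bipRay Δ) c) :
    2 * Δ - 2 ≤ k := by
  let s (i : Fin (Δ - 1)) : Fin Δ := ⟨i + 1, by omega⟩
  have hinj : Function.Injective fun x : Fin (Δ - 1) ⊕ Fin (Δ - 1) => c (.inl (Sum.map s s x)) := by
    rintro (i | i) (j | j) h
    · have := hd.eq_of_twins (by rintro ((l | l) | (l | l)) <;> simp [s]) h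
      simpa [s, Fin.ext_iff] using this
    · exact absurd h (hp _ _ (by simp [s]))
    · exact absurd h (hp _ _ (by simp [s]))
    · have := hd.eq_of_twins (by rintro ((l | l) | (l | l)) <;> simp [s]) h
      simpa [s, Fin.ext_iff] using this
  have := Fintype.card_le_of_injective _ hinj
  simp at this
  omega

end bipRay

/-- For `Δ ≥ 3`, the graph obtained from `K_{Δ,Δ}` by deleting an edge `uv` and
attaching rays at `u` and `v` is connected, has maximum degree `Δ`, and has
distinguishing chromatic number exactly `2Δ - 2`. -/
theorem bipRay_distinguishingChromaticNumber_eq (Δ : ℕ) (hΔ : 3 ≤ Δ) :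
    (bipRay Δ).Connected ∧
    (∀ v, ((bipRay Δ).neighborSet v).Finite ∧ ((bipRay Δ).neighborSet v).ncard ≤ Δ) ∧
    (∃ v, ((bipRay Δ).neighborSet v).ncard = Δ) ∧
    (∃ c : ((Fin Δ ⊕ Fin Δ) ⊕ (ℕ ⊕ ℕ)) → Fin (2 * Δ - 2),
      IsProperVertexColoring (bipRay Δ) c ∧
      IsDistinguishingVertexColoring (bipRay Δ) c) ∧
    (∀ k : ℕ, k < 2 * Δ - 2 →
      ¬ ∃ c : ((Fin Δ ⊕ Fin Δ) ⊕ (ℕ ⊕ ℕ)) → Fin k,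
        IsProperVertexColoring (bipRay Δ) c ∧
        IsDistinguishingVertexColoring (bipRay Δ) c) := by
  refine ⟨bipRay.connected hΔ, fun v => ⟨bipRay.finite_neighborSet (by omega) v, ?_⟩,
    ⟨.inl (.inl ⟨0, by omega⟩), bipRay.ncard_neighborSet_inl _⟩,
    ⟨fun v => ⟨bipRay.coloring Δ v, bipRay.coloring_lt hΔ v⟩, ?_, ?_⟩, ?_⟩
  · rcases v with v | v
    · exact (bipRay.ncard_neighborSet_inl v).le
    · exact (bipRay.ncard_neighborSet_inr_le (by omega) v).trans (by omega)
  · exact fun u v h he => bipRay.isProper_coloring hΔ u v h (Fin.mk.inj_iff.1 he)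
  · exact fun φ h => bipRay.isDistinguishing_coloring hΔ φ fun v => Fin.mk.inj_iff.1 (h v)
  · rintro k hk ⟨c, hp, hd⟩
    exact hk.not_ge (bipRay.two_mul_sub_two_le hp hd)
end
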